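/- Fix γ > −1. For every n ≥ 0 and 0 ≤ k ≤ n, the normal operator satisfies the eigenequation I₀^♯( μ^{−2γ−1} I₀( d^γ G_{n,k}^γ ) ) = (σ_{n,k}^γ)² G_{n,k}^γ on 𝔻, where (σ_{n,k}^γ)² = 2^{2γ+2} π binom(n,k) Γ(n−k+γ+1)Γ(k+γ+1)/Γ(n+2γ+2). -/

import Mathlib

open MeasureTheory Complex Metric Real Set

noncomputable section

/-! ## Geometry of the Euclidean disk and its space of lines (fan-beam coordinates) -/

/-- The chord of the closed unit disk through the boundary point `exp (I β)` with incoming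
direction `exp (I (β + π + α))`, parametrized by arclength `t ∈ [0, 2 cos α]`. -/
def chord (β α t : ℝ) : ℂ :=
  Complex.exp ((β : ℂ) * Complex.I) +
    (t : ℂ) * Complex.exp (((β + π + α : ℝ) : ℂ) * Complex.I)

/-- The X-ray transform `I₀` in fan-beam coordinates. -/
def XRT (f : ℂ → ℂ) (β α : ℝ) : ℂ :=
  ∫ t in (0:ℝ)..(2 * Real.cos α), f (chord β α t)

/-- The fan-beam coordinate `α₋(z, θ)` of the unique chord through `z` with direction `exp (I θ)`,
determined by `sin α₋ = Im (z * exp (-I θ))`. -/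
def alpham (z : ℂ) (θ : ℝ) : ℝ :=
  Real.arcsin ((z * Complex.exp (-(θ : ℂ) * Complex.I)).im)

/-- The fan-beam coordinate `β₋(z, θ)`, determined by `β₋ + α₋ + π = θ`. -/
def betam (z : ℂ) (θ : ℝ) : ℝ := θ - π - alpham z θ

/-- Reduction modulo `2π` to the fundamental interval `(0, 2π]`. -/
def wrap (x : ℝ) : ℝ := toIocMod Real.two_pi_pos 0 x

/-- The backprojection operator `I₀^♯`. -/
def BP (g : ℝ × ℝ → ℂ) (z : ℂ) : ℂ :=
  ∫ θ in (0:ℝ)..(2 * π), g (wrap (betam z θ), alpham z θ)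

/-- The weighted backprojection operator `I₀^♯ μ^{-2γ-1}`, where `μ(β, α) = cos α`. -/
def BPW (γ : ℝ) (g : ℝ × ℝ → ℂ) : ℂ → ℂ :=
  BP fun p => ((Real.cos p.2 ^ (-(2 * γ) - 1) : ℝ) : ℂ) * g p

/-- The rectangle `(0, 2π] × [-π/2, π/2]` modelling the space of lines `∂₊S𝔻`. -/
def Rect : Set (ℝ × ℝ) := Set.Ioc (0:ℝ) (2 * π) ×ˢ Set.Icc (-(π / 2)) (π / 2)

/-- The measure `μ^{-2γ} dβ dα` on `∂₊S𝔻`, where `μ(β, α) = cos α`. -/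
def bdryMeasure (γ : ℝ) : Measure (ℝ × ℝ) :=
  ((volume : Measure (ℝ × ℝ)).restrict Rect).withDensity
    fun p => ENNReal.ofReal (Real.cos p.2 ^ (-(2 * γ)))

/-- The measure `d^γ dz` on the closed unit disk, where `d(z) = 1 - |z|²`. -/
def diskMeasure (γ : ℝ) : Measure ℂ :=
  ((volume : Measure ℂ).restrict (Metric.closedBall 0 1)).withDensity
    fun z => ENNReal.ofReal ((1 - ‖z‖ ^ 2) ^ γ)

/-- `L n` is the monic orthogonal polynomial of degree `n` on `[-1, 1]` for the weight
`(1 - x²)^(γ + 1/2)`. -/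
def IsMonicOrtho (γ : ℝ) (L : ℕ → Polynomial ℝ) : Prop :=
  ∀ n, (L n).Monic ∧ (L n).natDegree = n ∧
    ∀ m, m < n →
      (∫ x in (-1:ℝ)..(1:ℝ), (L n).eval x * x ^ m * (1 - x ^ 2) ^ (γ + 1/2)) = 0

/-- The functions `ψ_{n,k}^γ = μ^{2γ+1} ((-1)^n / 2π) e^{i(n-2k)(β+α)} L_n^γ (sin α)`. -/
def psiF (γ : ℝ) (L : ℕ → Polynomial ℝ) (n : ℕ) (k : ℤ) (p : ℝ × ℝ) : ℂ :=
  ((Real.cos p.2 ^ (2 * γ + 1) : ℝ) : ℂ) * (((-1 : ℝ) ^ n / (2 * π) : ℝ) : ℂ) *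
    Complex.exp (Complex.I * ((n : ℂ) - 2 * (k : ℂ)) * ((p.1 + p.2 : ℝ) : ℂ)) *
    (((L n).eval (Real.sin p.2) : ℝ) : ℂ)

/-- The generalized Zernike polynomials
`G_{n,k}^γ (z) = (1/2π) ∫₀^{2π} e^{i(n-2k)θ} L_n^γ ((i/2)(z̄ e^{iθ} - z e^{-iθ})) dθ`. -/
def GZ (γ : ℝ) (L : ℕ → Polynomial ℝ) (n : ℕ) (k : ℤ) (z : ℂ) : ℂ :=
  ((1 / (2 * π) : ℝ) : ℂ) * ∫ θ in (0:ℝ)..(2 * π),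
    Complex.exp (Complex.I * ((n : ℂ) - 2 * (k : ℂ)) * (θ : ℂ)) *
      Polynomial.aeval
        ((Complex.I / 2) *
          ((starRingEnd ℂ) z * Complex.exp ((θ : ℂ) * Complex.I) -
            z * Complex.exp (-(θ : ℂ) * Complex.I))) (L n)

/-- `L²(𝔻, d^γ dz)`-norm. -/
def dNorm (γ : ℝ) (f : ℂ → ℂ) : ℝ := Real.sqrt (∫ z, ‖f z‖ ^ 2 ∂(diskMeasure γ))

/-- `L²(∂₊S𝔻, μ^{-2γ} dβ dα)`-norm. -/
def bNorm (γ : ℝ) (g : ℝ × ℝ → ℂ) : ℝ := Real.sqrt (∫ p, ‖g p‖ ^ 2 ∂(bdryMeasure γ))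

/-- `G_{n,k}^γ` normalized to unit norm in `L²(𝔻, d^γ dz)`. -/
def Ghat (γ : ℝ) (L : ℕ → Polynomial ℝ) (n : ℕ) (k : ℤ) (z : ℂ) : ℂ :=
  (((dNorm γ (GZ γ L n k))⁻¹ : ℝ) : ℂ) * GZ γ L n k z

/-- `ψ_{n,k}^γ` normalized to unit norm in `L²(∂₊S𝔻, μ^{-2γ} dβ dα)`. -/
def psihat (γ : ℝ) (L : ℕ → Polynomial ℝ) (n : ℕ) (k : ℤ) (p : ℝ × ℝ) : ℂ :=
  (((bNorm γ (psiF γ L n k))⁻¹ : ℝ) : ℂ) * psiF γ L n k p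

/-- The squared singular values `(σ_{n,k}^γ)²`. -/
def sigSq (γ : ℝ) (n k : ℕ) : ℝ :=
  2 ^ (2 * γ + 2) * π * (n.choose k) *
    Real.Gamma ((n : ℝ) - k + γ + 1) * Real.Gamma ((k : ℝ) + γ + 1) /
      Real.Gamma ((n : ℝ) + 2 * γ + 2)

/-- The singular values `σ_{n,k}^γ ≥ 0`. -/
def sig (γ : ℝ) (n k : ℕ) : ℝ := Real.sqrt (sigSq γ n k)

/-- The Beta function `B(x,y) = Γ(x)Γ(y)/Γ(x+y)`. -/
def betaFn (x y : ℝ) : ℝ := Real.Gamma x * Real.Gamma y / Real.Gamma (x + y)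

/-! ## Differential operators -/

/-- Radial derivative `∂_ρ` in polar coordinates `z = ρ e^{iω}`. -/
def dRho (f : ℂ → ℂ) (z : ℂ) : ℂ :=
  deriv (fun r : ℝ => f ((r : ℂ) * Complex.exp ((z.arg : ℂ) * Complex.I))) ‖z‖

/-- Angular derivative `∂_ω` in polar coordinates `z = ρ e^{iω}`. -/
def dOmega (f : ℂ → ℂ) (z : ℂ) : ℂ :=
  deriv (fun w : ℝ => f ((‖z‖ : ℂ) * Complex.exp ((w : ℂ) * Complex.I))) z.arg

/-- The operator `𝓛_γ = -(1-ρ²)∂_ρ² - (ρ⁻¹ - (3+2γ)ρ)∂_ρ - ρ⁻²∂_ω² + (γ+1)²`. -/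
def Lop (γ : ℝ) (f : ℂ → ℂ) (z : ℂ) : ℂ :=
  -(1 - (‖z‖ : ℂ) ^ 2) * dRho (dRho f) z -
    ((‖z‖ : ℂ)⁻¹ - (3 + 2 * (γ : ℂ)) * (‖z‖ : ℂ)) * dRho f z -
    ((‖z‖ : ℂ) ^ 2)⁻¹ * dOmega (dOmega f) z + ((γ : ℂ) + 1) ^ 2 * f z

/-- `∂_β` on `∂₊S𝔻`. -/
def dBeta (g : ℝ × ℝ → ℂ) (p : ℝ × ℝ) : ℂ := deriv (fun b : ℝ => g (b, p.2)) p.1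

/-- `∂_α` on `∂₊S𝔻`. -/
def dAlpha (g : ℝ × ℝ → ℂ) (p : ℝ × ℝ) : ℂ := deriv (fun a : ℝ => g (p.1, a)) p.2

/-- The operator `T = ∂_β - ∂_α`. -/
def Tline (g : ℝ × ℝ → ℂ) (p : ℝ × ℝ) : ℂ := dBeta g p - dAlpha g p

/-- The power `μ^e = (cos α)^e` as a complex-valued function on `∂₊S𝔻`. -/
def muC (e : ℝ) (p : ℝ × ℝ) : ℂ := ((Real.cos p.2 ^ e : ℝ) : ℂ)

/-- The operator `𝓣_γ = -μ^{2γ} T μ^{-2γ} T + γ²`. -/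
def Tgam (γ : ℝ) (g : ℝ × ℝ → ℂ) (p : ℝ × ℝ) : ℂ :=
  -muC (2 * γ) p * Tline (fun q => muC (-(2 * γ)) q * Tline g q) p + (γ : ℂ) ^ 2 * g p

/-! ## Scattering relations and the space `C^∞_{α,+,+}(∂₊S𝔻)` -/

/-- The scattering relation `𝒮(β, α) = (β + π + 2α, π - α)`. -/
def Scat (p : ℝ × ℝ) : ℝ × ℝ := (p.1 + π + 2 * p.2, π - p.2)

/-- The antipodal scattering relation `𝒮_A(β, α) = (β + π + 2α, -α)`. -/
def ScatA (p : ℝ × ℝ) : ℝ × ℝ := (p.1 + π + 2 * p.2, -p.2)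

/-- Membership in `C^∞_{α,+,+}(∂₊S𝔻)`: `f`, given on the strip `ℝ × [-π/2, π/2]` (2π-periodically
in β), has an even extension through the scattering relation which is smooth on all of `∂S𝔻`
(modelled as a doubly 2π-periodic smooth function on `ℝ²` invariant under `𝒮`), and `f` is
invariant under the antipodal scattering relation. -/
def MemCapp (f : ℝ × ℝ → ℂ) : Prop :=
  ∃ F : ℝ × ℝ → ℂ, ContDiff ℝ (⊤ : ℕ∞) F ∧
    (∀ p : ℝ × ℝ, F (p.1 + 2 * π, p.2) = F p) ∧
    (∀ p : ℝ × ℝ, F (p.1, p.2 + 2 * π) = F p) ∧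
    (∀ p : ℝ × ℝ, F (Scat p) = F p) ∧
    (∀ p : ℝ × ℝ, p.2 ∈ Set.Icc (-(π / 2)) (π / 2) → F (ScatA p) = F p) ∧
    (∀ p : ℝ × ℝ, p.2 ∈ Set.Icc (-(π / 2)) (π / 2) → f p = F p)

/-- `C^∞(𝔻)`: smooth up to the boundary of the closed unit disk. -/
def CinfDisk (f : ℂ → ℂ) : Prop := ContDiffOn ℝ (⊤ : ℕ∞) f (Metric.closedBall 0 1)

end

noncomputable section

theorem intervalIntegrable_rpow_mul_rpow {a b : ℝ} (ha : 0 < a) (hb : 0 < b) :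
    IntervalIntegrable (fun x : ℝ => x ^ (a - 1) * (1 - x) ^ (b - 1)) volume 0 1 := by
  have h := Complex.betaIntegral_convergent (u := a) (v := b) (by simpa) (by simpa)
  rw [intervalIntegrable_iff_integrableOn_Ioc_of_le zero_le_one] at h ⊢
  refine IntegrableOn.congr_fun h.re (fun x hx => ?_) measurableSet_Ioc
  have h0 : (0:ℝ) ≤ 1 - x := by linarith [hx.2]
  have e : (x:ℂ) ^ ((a:ℂ) - 1) * (1 - (x:ℂ)) ^ ((b:ℂ) - 1)
      = ((x ^ (a - 1) * (1 - x) ^ (b - 1) : ℝ) : ℂ) := by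
    push_cast [Complex.ofReal_cpow hx.1.le, Complex.ofReal_cpow h0]; rfl
  simp only [e, RCLike.re_to_complex, Complex.ofReal_re]

theorem integral_rpow_mul_rpow {a b : ℝ} (ha : 0 < a) (hb : 0 < b) :
    ∫ x in (0:ℝ)..1, x ^ (a - 1) * (1 - x) ^ (b - 1)
      = Real.Gamma a * Real.Gamma b / Real.Gamma (a + b) := by
  have h := ProbabilityTheory.beta_eq_betaIntegralReal a b ha hb
  rw [ProbabilityTheory.beta] at h
  rw [h, Complex.betaIntegral, ← Complex.ofReal_re (∫ x in (0:ℝ)..1, _),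
    ← intervalIntegral.integral_ofReal]
  congr 1
  refine intervalIntegral.integral_congr fun x hx => ?_
  rw [uIcc_of_le zero_le_one] at hx
  have h0 : (0:ℝ) ≤ 1 - x := by linarith [hx.2]
  push_cast [Complex.ofReal_cpow hx.1, Complex.ofReal_cpow h0]; rfl

theorem one_sub_sq_rpow_mul {γ v : ℝ} (hv : v ∈ Ioo (-1:ℝ) 1) (i j : ℕ) :
    (1 - v ^ 2) ^ γ * (((1 + v) / 2) ^ i * ((1 - v) / 2) ^ j) =
      4 ^ γ * ((1/2 * v + 1/2) ^ ((i + γ + 1 : ℝ) - 1) *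
        (1 - (1/2 * v + 1/2)) ^ ((j + γ + 1 : ℝ) - 1)) := by
  have h1 : (0:ℝ) < 1/2 * v + 1/2 := by linarith [hv.1]
  have h2 : (0:ℝ) < 1 - (1/2 * v + 1/2) := by linarith [hv.2]
  rw [show 1 - v ^ 2 = 4 * ((1/2 * v + 1/2) * (1 - (1/2 * v + 1/2))) by ring,
    Real.mul_rpow (by norm_num) (by positivity), Real.mul_rpow h1.le h2.le,
    show (i + γ + 1 : ℝ) - 1 = γ + i by ring, show (j + γ + 1 : ℝ) - 1 = γ + j by ring,
    Real.rpow_add_natCast h1.ne', Real.rpow_add_natCast h2.ne',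
    show (1 + v) / 2 = 1/2 * v + 1/2 by ring, show (1 - v) / 2 = 1 - (1/2 * v + 1/2) by ring]
  ring

theorem intervalIntegrable_one_sub_sq_rpow {γ : ℝ} (hγ : -1 < γ) :
    IntervalIntegrable (fun v : ℝ => (1 - v ^ 2) ^ γ) volume (-1) 1 := by
  have h := (intervalIntegrable_rpow_mul_rpow (a := γ + 1) (b := γ + 1) (by linarith)
    (by linarith)).comp_mul_right (c := 1/2)
  have h := (h.comp_add_right 1).const_mul (4 ^ γ)
  norm_num at h
  rw [intervalIntegrable_iff_integrableOn_Ioo_of_le (by norm_num)] at h ⊢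
  refine IntegrableOn.congr_fun h (fun v hv => ?_) measurableSet_Ioo
  have := one_sub_sq_rpow_mul (γ := γ) hv 0 0
  simp at this
  rw [this]
  ring_nf

theorem integral_one_sub_sq_rpow_mul {γ : ℝ} (hγ : -1 < γ) (i j : ℕ) :
    ∫ v in (-1:ℝ)..1, (1 - v ^ 2) ^ γ * (((1 + v) / 2) ^ i * ((1 - v) / 2) ^ j)
      = 2 ^ (2 * γ + 1) * (Real.Gamma (i + γ + 1) * Real.Gamma (j + γ + 1) /
        Real.Gamma (i + j + 2 * γ + 2)) := by
  have hi : (0:ℝ) < i + γ + 1 := by have := i.cast_nonneg (α := ℝ); linarith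
  have hj : (0:ℝ) < j + γ + 1 := by have := j.cast_nonneg (α := ℝ); linarith
  rw [intervalIntegral.integral_of_le (by norm_num), integral_Ioc_eq_integral_Ioo,
    setIntegral_congr_fun measurableSet_Ioo fun v hv => one_sub_sq_rpow_mul hv i j,
    ← integral_Ioc_eq_integral_Ioo, ← intervalIntegral.integral_of_le (by norm_num),
    intervalIntegral.integral_const_mul]
  rw [intervalIntegral.integral_comp_mul_add
    (fun x : ℝ => x ^ ((i + γ + 1 : ℝ) - 1) * (1 - x) ^ ((j + γ + 1 : ℝ) - 1)) (by norm_num),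
    show (1 / 2 * -1 + 1 / 2 : ℝ) = 0 by norm_num, show (1 / 2 * 1 + 1 / 2 : ℝ) = 1 by norm_num,
    integral_rpow_mul_rpow hi hj, Real.rpow_add_one (by norm_num), Real.rpow_mul (by norm_num),
    show (i + γ + 1 + (j + γ + 1) : ℝ) = i + j + 2 * γ + 2 by ring]
  norm_num
  ring

theorem intervalIntegrable_weight_mul {γ : ℝ} (hγ : -1 < γ) {g : ℝ → ℝ} (hg : Continuous g) :
    IntervalIntegrable (fun v : ℝ => (1 - v ^ 2) ^ γ * g v) volume (-1) 1 :=
  (intervalIntegrable_one_sub_sq_rpow hγ).mul_continuousOn hg.continuousOn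

theorem intervalIntegrable_weight_mul_complex {γ : ℝ} (hγ : -1 < γ) {g : ℝ → ℂ}
    (hg : Continuous g) :
    IntervalIntegrable (fun v : ℝ => (((1 - v ^ 2) ^ γ : ℝ) : ℂ) * g v) volume (-1) 1 := by
  refine IntervalIntegrable.mul_continuousOn ?_ hg.continuousOn
  have h := intervalIntegrable_one_sub_sq_rpow hγ
  rw [intervalIntegrable_iff] at h ⊢
  exact h.ofReal

theorem integral_weight_mul_odd_pow (γ : ℝ) {j : ℕ} (hj : Odd j) :
    ∫ v in (-1:ℝ)..1, (1 - v ^ 2) ^ γ * v ^ j = 0 := by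
  have h := intervalIntegral.integral_comp_neg (a := -1) (b := 1)
    (fun v : ℝ => (1 - v ^ 2) ^ γ * v ^ j)
  simp only [hj.neg_pow, even_two.neg_pow, mul_neg, intervalIntegral.integral_neg, neg_neg] at h
  linarith

theorem exists_polynomial_weighted_pow (γ : ℝ) (j : ℕ) :
    ∃ r : Polynomial ℝ, r.natDegree ≤ j ∧
      (∀ s ∈ Icc (-1:ℝ) 1,
        r.eval s = ∫ v in (-1:ℝ)..1, (1 - v ^ 2) ^ γ * (√(1 - s ^ 2) * v) ^ j) ∧
      (r.coeff j : ℂ) =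
        ∫ v in (-1:ℝ)..1, (((1 - v ^ 2) ^ γ : ℝ) : ℂ) * (Complex.I * v) ^ j := by
  have hc : ∫ v in (-1:ℝ)..1, (((1 - v ^ 2) ^ γ : ℝ) : ℂ) * (Complex.I * v) ^ j =
      Complex.I ^ j * ((∫ v in (-1:ℝ)..1, (1 - v ^ 2) ^ γ * v ^ j : ℝ) : ℂ) := by
    rw [← intervalIntegral.integral_ofReal, ← intervalIntegral.integral_const_mul]
    congr 1; ext v; push_cast; ring
  have hr : ∀ s, ∫ v in (-1:ℝ)..1, (1 - v ^ 2) ^ γ * (√(1 - s ^ 2) * v) ^ j =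
      √(1 - s ^ 2) ^ j * ∫ v in (-1:ℝ)..1, (1 - v ^ 2) ^ γ * v ^ j := by
    intro s
    rw [← intervalIntegral.integral_const_mul]
    congr 1; ext v; ring
  simp only [hc, hr]
  rcases Nat.even_or_odd j with hj | hj
  · obtain ⟨i, rfl⟩ := hj
    set M := ∫ v in (-1:ℝ)..1, (1 - v ^ 2) ^ γ * v ^ (i + i)
    have hd : (1 - Polynomial.X ^ 2 : Polynomial ℝ).natDegree ≤ 2 := by compute_degree
    have hco := Polynomial.coeff_pow_of_natDegree_le (m := i) hd
    refine ⟨Polynomial.C M * (1 - Polynomial.X ^ 2) ^ i, ?_, fun s hs => ?_, ?_⟩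
    · refine (Polynomial.natDegree_C_mul_le _ _).trans
        ((Polynomial.natDegree_pow_le_of_le i hd).trans (by omega))
    · have : 0 ≤ 1 - s ^ 2 := by nlinarith [hs.1, hs.2]
      simp only [Polynomial.eval_mul, Polynomial.eval_C, Polynomial.eval_pow, Polynomial.eval_sub,
        Polynomial.eval_one, Polynomial.eval_X]
      rw [← two_mul, pow_mul, Real.sq_sqrt this, mul_comm]
    · rw [Polynomial.coeff_C_mul, show i + i = i * 2 by ring, hco, mul_comm i 2, pow_mul,
        Complex.I_sq]
      simp [Polynomial.coeff_one, mul_comm]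
  · rw [integral_weight_mul_odd_pow γ hj]
    exact ⟨0, by simp⟩

theorem exists_polynomial_weighted_add_pow {γ : ℝ} (hγ : -1 < γ) (a b : ℝ) (m : ℕ) :
    ∃ q : Polynomial ℝ, q.natDegree ≤ m ∧
      (∀ s ∈ Icc (-1:ℝ) 1,
        q.eval s = ∫ v in (-1:ℝ)..1, (1 - v ^ 2) ^ γ * (√(1 - s ^ 2) * v * a + s * b) ^ m) ∧
      (q.coeff m : ℂ) =
        ∫ v in (-1:ℝ)..1, (((1 - v ^ 2) ^ γ : ℝ) : ℂ) * (Complex.I * v * a + b) ^ m := by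
  choose r hrd hre hrc using exists_polynomial_weighted_pow γ
  refine ⟨∑ j ∈ Finset.range (m + 1), r j *
    (Polynomial.C (a ^ j * b ^ (m - j) * m.choose j) * Polynomial.X ^ (m - j)), ?_, ?_, ?_⟩
  · refine Polynomial.natDegree_sum_le_of_forall_le _ _ fun j hj => ?_
    have hj := Finset.mem_range_succ_iff.1 hj
    have h1 := Polynomial.natDegree_C_mul_X_pow_le (a ^ j * b ^ (m - j) * m.choose j) (m - j)
    refine Polynomial.natDegree_mul_le.trans ?_
    have := hrd j
    omega
  · intro s hs
    simp only [add_pow, Finset.mul_sum]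
    rw [intervalIntegral.integral_finsetSum fun j _ =>
      intervalIntegrable_weight_mul hγ (by fun_prop), Polynomial.eval_finsetSum]
    refine Finset.sum_congr rfl fun j _ => ?_
    rw [Polynomial.eval_mul, hre j s hs, ← intervalIntegral.integral_mul_const]
    congr 1; ext v
    simp only [Polynomial.eval_mul, Polynomial.eval_C, Polynomial.eval_pow, Polynomial.eval_X]
    ring
  · simp only [add_pow, Finset.mul_sum]
    rw [intervalIntegral.integral_finsetSum fun j _ =>
      intervalIntegrable_weight_mul_complex hγ (by fun_prop), Polynomial.finsetSum_coeff,
      Complex.ofReal_sum]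
    refine Finset.sum_congr rfl fun j hj => ?_
    have hj := Finset.mem_range_succ_iff.1 hj
    rw [← mul_assoc, Polynomial.coeff_mul_X_pow', if_pos (Nat.sub_le _ _), Nat.sub_sub_self hj,
      Polynomial.coeff_mul_C, Complex.ofReal_mul, hrc j, ← intervalIntegral.integral_mul_const]
    congr 1; ext v
    push_cast
    ring

/-- Averaging a polynomial over the weighted chords of the disk gives a polynomial of no larger
degree, whose top coefficient is explicit. -/
theorem exists_polynomial_weighted_mean {γ : ℝ} (hγ : -1 < γ) (a b : ℝ) {n : ℕ}
    {p : Polynomial ℝ} (hp : p.natDegree ≤ n) :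
    ∃ q : Polynomial ℝ, q.natDegree ≤ n ∧
      (∀ s ∈ Icc (-1:ℝ) 1,
        q.eval s = ∫ v in (-1:ℝ)..1, (1 - v ^ 2) ^ γ * p.eval (√(1 - s ^ 2) * v * a + s * b)) ∧
      (q.coeff n : ℂ) = p.coeff n *
        ∫ v in (-1:ℝ)..1, (((1 - v ^ 2) ^ γ : ℝ) : ℂ) * (Complex.I * v * a + b) ^ n := by
  choose r hrd hre hrc using exists_polynomial_weighted_add_pow hγ a b
  refine ⟨∑ m ∈ Finset.range (n + 1), Polynomial.C (p.coeff m) * r m, ?_, ?_, ?_⟩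
  · refine Polynomial.natDegree_sum_le_of_forall_le _ _ fun j hj => ?_
    exact (Polynomial.natDegree_C_mul_le _ _).trans
      ((hrd j).trans (Finset.mem_range_succ_iff.1 hj))
  · intro s hs
    simp only [Polynomial.eval_eq_sum_range' (Nat.lt_succ_of_le hp), Finset.mul_sum]
    rw [intervalIntegral.integral_finsetSum fun j _ =>
      intervalIntegrable_weight_mul hγ (by fun_prop), Polynomial.eval_finsetSum]
    refine Finset.sum_congr rfl fun j _ => ?_
    rw [Polynomial.eval_mul, hre j s hs, Polynomial.eval_C, ← intervalIntegral.integral_const_mul]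
    congr 1; ext v
    ring
  · rw [Polynomial.finsetSum_coeff, Finset.sum_range_succ, Finset.sum_eq_zero, zero_add,
      Polynomial.coeff_C_mul, Complex.ofReal_mul, hrc]
    intro j hj
    rw [Polynomial.coeff_C_mul, Polynomial.coeff_eq_zero_of_natDegree_lt
      ((hrd j).trans_lt (Finset.mem_range.1 hj)), mul_zero]

/-- A polynomial of degree at most `n` orthogonal to all lower degrees is a multiple of `L n`. -/
theorem IsMonicOrtho.eq_C_mul {γ : ℝ} (hγ : -1 < γ) {L : ℕ → Polynomial ℝ}
    (hL : IsMonicOrtho γ L) {n : ℕ} {q : Polynomial ℝ} (hq : q.natDegree ≤ n)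
    (ho : ∀ m < n, ∫ x in (-1:ℝ)..1, q.eval x * x ^ m * (1 - x ^ 2) ^ (γ + 1/2) = 0) :
    q = Polynomial.C (q.coeff n) * L n := by
  obtain ⟨hm, hd, hLo⟩ := hL n
  set r := q - Polynomial.C (q.coeff n) * L n with hr
  have hint : ∀ p : Polynomial ℝ, ∀ m : ℕ, IntervalIntegrable
      (fun x => p.eval x * x ^ m * (1 - x ^ 2) ^ (γ + 1/2)) volume (-1) 1 := fun p m => by
    simpa only [mul_comm] using intervalIntegrable_weight_mul (γ := γ + 1/2) (by linarith)
      (g := fun x => p.eval x * x ^ m) (by fun_prop)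
  have hro : ∀ m < n, ∫ x in (-1:ℝ)..1, r.eval x * x ^ m * (1 - x ^ 2) ^ (γ + 1/2) = 0 := by
    intro m hmn
    have h := intervalIntegral.integral_sub (hint q m) ((hint (L n) m).const_mul (q.coeff n))
    rw [ho m hmn, intervalIntegral.integral_const_mul, hLo m hmn, mul_zero, sub_zero] at h
    rw [← h]
    congr 1; ext x
    simp only [hr, Polynomial.eval_sub, Polynomial.eval_mul, Polynomial.eval_C]
    ring
  have hrd : r.degree < n := by
    rw [Polynomial.degree_lt_iff_coeff_zero]
    intro m hnm
    rcases hnm.eq_or_lt with rfl | h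
    · have : (L n).coeff n = 1 := by
        rw [← hm.coeff_natDegree, hd]
      simp [hr, this]
    · simp [hr, Polynomial.coeff_eq_zero_of_natDegree_lt (hq.trans_lt h),
        Polynomial.coeff_eq_zero_of_natDegree_lt (hd.trans_lt h)]
  have hsq : ∫ x in (-1:ℝ)..1, r.eval x ^ 2 * (1 - x ^ 2) ^ (γ + 1/2) = 0 := by
    have : ∀ x : ℝ, r.eval x ^ 2 * (1 - x ^ 2) ^ (γ + 1/2) = ∑ m ∈ r.support,
        r.coeff m * (r.eval x * x ^ m * (1 - x ^ 2) ^ (γ + 1/2)) := fun x => by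
      rw [sq]
      nth_rewrite 1 [Polynomial.eval_eq_sum]
      rw [Polynomial.sum, Finset.sum_mul, Finset.sum_mul]
      exact Finset.sum_congr rfl fun m _ => by ring
    simp only [this]
    rw [intervalIntegral.integral_finsetSum fun m _ => (hint r m).const_mul _]
    refine Finset.sum_eq_zero fun m hmn => ?_
    rw [intervalIntegral.integral_const_mul, hro m, mul_zero]
    by_contra! h
    exact Polynomial.mem_support_iff.1 hmn ((Polynomial.degree_lt_iff_coeff_zero r n).1 hrd m h)
  have hpos : ∀ x ∈ Ioo (-1:ℝ) 1, 0 < (1 - x ^ 2) ^ (γ + 1/2) := fun x hx =>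
    Real.rpow_pos_of_pos (by nlinarith [hx.1, hx.2]) _
  have hi : IntervalIntegrable (fun x => r.eval x ^ 2 * (1 - x ^ 2) ^ (γ + 1/2)) volume (-1) 1 := by
    simpa only [mul_comm] using intervalIntegrable_weight_mul (γ := γ + 1/2) (by linarith)
      (g := fun x => r.eval x ^ 2) (by fun_prop)
  rw [intervalIntegrable_iff_integrableOn_Ioo_of_le (by norm_num)] at hi
  rw [intervalIntegral.integral_of_le (by norm_num), integral_Ioc_eq_integral_Ioo,
    setIntegral_eq_zero_iff_of_nonneg_ae ?_ hi] at hsq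
  · have hae : (fun x => r.eval x) =ᵐ[volume.restrict (Ioo (-1) 1)] fun _ => 0 := by
      filter_upwards [hsq, ae_restrict_mem measurableSet_Ioo] with x hx hx1
      exact (pow_eq_zero_iff two_ne_zero).1 ((mul_eq_zero.1 hx).resolve_right (hpos x hx1).ne')
    have heq := Measure.eqOn_Ioo_of_ae_eq volume hae (by fun_prop) (by fun_prop)
    have : r = 0 := Polynomial.eq_zero_of_infinite_isRoot r
      ((Ioo_infinite (by norm_num : (-1:ℝ) < 1)).mono fun x hx => heq hx)
    exact sub_eq_zero.1 this
  · filter_upwards [ae_restrict_mem measurableSet_Ioo] with x hx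
    exact mul_nonneg (sq_nonneg _) (hpos x hx).le

theorem integral_sq_sub_sq_rpow_smul {E : Type*} [NormedAddCommGroup E] [NormedSpace ℝ E]
    (γ : ℝ) {c : ℝ} (hc : 0 < c) (F : ℝ → E) :
    ∫ u in (-c)..c, (c ^ 2 - u ^ 2) ^ γ • F u =
      (c ^ 2) ^ (γ + 1/2) • ∫ v in (-1:ℝ)..1, (1 - v ^ 2) ^ γ • F (c * v) := by
  have h := intervalIntegral.smul_integral_comp_mul_left (a := -1) (b := 1)
    (fun u => (c ^ 2 - u ^ 2) ^ γ • F u) c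
  rw [mul_neg, mul_one] at h
  have hcc : (c ^ 2) ^ (γ + 1/2) = c * (c ^ 2) ^ γ := by
    rw [Real.rpow_add (by positivity), ← Real.sqrt_eq_rpow, Real.sqrt_sq hc.le, mul_comm]
  rw [← h, hcc, mul_smul, ← intervalIntegral.integral_smul ((c ^ 2) ^ γ)]
  congr 1
  refine intervalIntegral.integral_congr fun v hv => ?_
  rw [uIcc_of_le (by norm_num)] at hv
  have : 0 ≤ 1 - v ^ 2 := by nlinarith [hv.1, hv.2]
  simp only [smul_smul]
  rw [← Real.mul_rpow (by positivity) this]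
  ring_nf

/-- The weight `(1 - |z|²)^γ` on the open unit disk, extended by zero. -/
def diskWeight (γ : ℝ) : ℂ → ℝ := (Metric.ball 0 1).indicator fun z => (1 - ‖z‖ ^ 2) ^ γ

theorem measurable_diskWeight (γ : ℝ) : Measurable (diskWeight γ) :=
  Measurable.indicator (by fun_prop) measurableSet_ball

theorem diskWeight_nonneg (γ : ℝ) (z : ℂ) : 0 ≤ diskWeight γ z := by
  refine indicator_nonneg (fun z hz => Real.rpow_nonneg ?_ _) z
  rw [mem_ball_zero_iff] at hz
  nlinarith [norm_nonneg z]

theorem diskWeight_mk_eq_indicator (γ : ℝ) {s : ℝ} (hs : s ∈ Ioo (-1:ℝ) 1) :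
    (fun u : ℝ => diskWeight γ ⟨u, s⟩) = (Ioo (-√(1 - s ^ 2)) √(1 - s ^ 2)).indicator
      fun u => (√(1 - s ^ 2) ^ 2 - u ^ 2) ^ γ := by
  classical
  have hs' : 0 ≤ 1 - s ^ 2 := by nlinarith [hs.1, hs.2]
  ext u
  have hn : ‖(⟨u, s⟩ : ℂ)‖ ^ 2 = u ^ 2 + s ^ 2 := by
    rw [Complex.sq_norm, Complex.normSq_apply]; ring
  have hiff : (⟨u, s⟩ : ℂ) ∈ Metric.ball (0:ℂ) 1 ↔ u ∈ Ioo (-√(1 - s ^ 2)) √(1 - s ^ 2) := by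
    rw [mem_ball_zero_iff, ← sq_lt_one_iff₀ (norm_nonneg _), hn, mem_Ioo, ← abs_lt,
      Real.lt_sqrt (abs_nonneg u), sq_abs]
    constructor <;> intro h <;> linarith
  simp only [diskWeight, indicator_apply, hiff, hn, Real.sq_sqrt hs']
  ring_nf

theorem diskWeight_mk_eq_zero (γ : ℝ) {s : ℝ} (hs : s ∉ Ioo (-1:ℝ) 1) (u : ℝ) :
    diskWeight γ ⟨u, s⟩ = 0 := by
  refine indicator_of_notMem (fun h => hs ?_) _
  rw [mem_ball_zero_iff] at h
  exact abs_lt.1 ((Complex.abs_im_le_norm ⟨u, s⟩).trans_lt h)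

theorem integral_diskWeight_mk_mul (γ : ℝ) {s : ℝ} (hs : s ∈ Ioo (-1:ℝ) 1) (g : ℝ → ℝ) :
    ∫ u, diskWeight γ ⟨u, s⟩ * g u = (1 - s ^ 2) ^ (γ + 1/2) *
      ∫ v in (-1:ℝ)..1, (1 - v ^ 2) ^ γ * g (√(1 - s ^ 2) * v) := by
  have hs' : 0 < 1 - s ^ 2 := by nlinarith [hs.1, hs.2]
  have h := integral_sq_sub_sq_rpow_smul γ (Real.sqrt_pos.2 hs') g
  simp only [smul_eq_mul] at h
  have h2 := Real.sq_sqrt hs'.le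
  rw [show (1 - s ^ 2) ^ (γ + 1/2) = (√(1 - s ^ 2) ^ 2) ^ (γ + 1/2) by rw [h2], ← h,
    intervalIntegral.integral_of_le (by linarith [Real.sqrt_nonneg (1 - s ^ 2)]),
    integral_Ioc_eq_integral_Ioo, ← integral_indicator measurableSet_Ioo]
  congr 1; ext u
  rw [congrFun (diskWeight_mk_eq_indicator γ hs) u, indicator_mul_left]

theorem integrable_diskWeight_mk {γ : ℝ} (hγ : -1 < γ) (s : ℝ) :
    Integrable fun u : ℝ => diskWeight γ ⟨u, s⟩ := by
  by_cases hs : s ∈ Ioo (-1:ℝ) 1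
  · have hs' : 0 < √(1 - s ^ 2) := Real.sqrt_pos.2 (by nlinarith [hs.1, hs.2])
    rw [diskWeight_mk_eq_indicator γ hs, integrable_indicator_iff measurableSet_Ioo,
      ← intervalIntegrable_iff_integrableOn_Ioo_of_le (by linarith)]
    have h := ((intervalIntegrable_one_sub_sq_rpow hγ).comp_mul_left
      (c := (√(1 - s ^ 2))⁻¹)).const_mul ((√(1 - s ^ 2) ^ 2) ^ γ)
    simp only [div_inv_eq_mul, neg_mul, one_mul] at h
    refine (intervalIntegrable_congr fun u hu => ?_).1 h
    rw [uIoc_of_le (by linarith)] at hu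
    rw [← Real.mul_rpow (by positivity)]
    · congr 1
      field_simp
    · rw [sub_nonneg, sq_le_one_iff_abs_le_one, abs_mul, abs_inv, abs_of_pos hs',
        inv_mul_le_iff₀ hs', mul_one, abs_le]
      exact ⟨hu.1.le, hu.2⟩
  · simp [diskWeight_mk_eq_zero γ hs]

theorem integrable_diskWeight_prod {γ : ℝ} (hγ : -1 < γ) :
    Integrable (fun p : ℝ × ℝ => diskWeight γ ⟨p.1, p.2⟩) (volume.prod volume) := by
  rw [integrable_prod_iff']
  · refine ⟨Filter.Eventually.of_forall fun s => integrable_diskWeight_mk hγ s, ?_⟩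
    have h := (intervalIntegrable_one_sub_sq_rpow (γ := γ + 1/2) (by linarith)).mul_const
      (∫ v in (-1:ℝ)..1, (1 - v ^ 2) ^ γ)
    rw [intervalIntegrable_iff_integrableOn_Ioo_of_le (by norm_num),
      ← integrable_indicator_iff measurableSet_Ioo] at h
    refine h.congr (Filter.Eventually.of_forall fun s => ?_)
    simp only [Real.norm_of_nonneg (diskWeight_nonneg γ _)]
    by_cases hs : s ∈ Ioo (-1:ℝ) 1
    · simpa [indicator_of_mem hs] using (integral_diskWeight_mk_mul γ hs fun _ => 1).symm
    · simp [diskWeight_mk_eq_zero γ hs, indicator_of_notMem hs]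
  · exact ((measurable_diskWeight γ).comp
      Complex.measurableEquivRealProd.symm.measurable).aestronglyMeasurable

theorem integrable_diskWeight {γ : ℝ} (hγ : -1 < γ) : Integrable (diskWeight γ) :=
  (Complex.volume_preserving_equiv_real_prod.symm.integrable_comp_emb
    Complex.measurableEquivRealProd.symm.measurableEmbedding).1 (integrable_diskWeight_prod hγ)

theorem integrable_diskWeight_mul {γ : ℝ} (hγ : -1 < γ) {f : ℂ → ℝ} (hf : Continuous f) :
    Integrable fun z => diskWeight γ z * f z := by
  obtain ⟨C, hC⟩ := (isCompact_closedBall (0:ℂ) 1).exists_bound_of_continuousOn hf.continuousOn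
  refine ((integrable_diskWeight hγ).mul_const C).mono'
    ((measurable_diskWeight γ).mul hf.measurable).aestronglyMeasurable
    (Filter.Eventually.of_forall fun z => ?_)
  rw [norm_mul, Real.norm_of_nonneg (diskWeight_nonneg γ z)]
  by_cases hz : z ∈ Metric.ball (0:ℂ) 1
  · exact mul_le_mul_of_nonneg_left (hC z (ball_subset_closedBall hz)) (diskWeight_nonneg γ z)
  · simp [diskWeight, hz]

/-- Integration over the disk by horizontal slices. -/
theorem integral_diskWeight_mul {γ : ℝ} (hγ : -1 < γ) {f : ℂ → ℝ} (hf : Continuous f) :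
    ∫ z, diskWeight γ z * f z = ∫ s in (-1:ℝ)..1, (1 - s ^ 2) ^ (γ + 1/2) *
      ∫ v in (-1:ℝ)..1, (1 - v ^ 2) ^ γ * f ⟨√(1 - s ^ 2) * v, s⟩ := by
  have hmp := Complex.volume_preserving_equiv_real_prod.symm
  have hemb := Complex.measurableEquivRealProd.symm.measurableEmbedding
  rw [← hmp.integral_comp hemb, Measure.volume_eq_prod, integral_prod_symm
    (fun p : ℝ × ℝ => diskWeight γ (Complex.measurableEquivRealProd.symm p) *
      f (Complex.measurableEquivRealProd.symm p))
    ((hmp.integrable_comp_emb hemb).2 (integrable_diskWeight_mul hγ hf)),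
    intervalIntegral.integral_of_le (by norm_num), integral_Ioc_eq_integral_Ioo,
    ← integral_indicator measurableSet_Ioo]
  congr 1; ext s
  by_cases hs : s ∈ Ioo (-1:ℝ) 1
  · rw [indicator_of_mem hs]
    exact integral_diskWeight_mk_mul γ hs fun u => f ⟨u, s⟩
  · rw [indicator_of_notMem hs]
    refine integral_eq_zero_of_ae (Filter.Eventually.of_forall fun u => ?_)
    exact mul_eq_zero_of_left (diskWeight_mk_eq_zero γ hs u) _

theorem integral_diskWeight_mul_rotation (γ τ : ℝ) (f : ℂ → ℝ) :
    ∫ z, diskWeight γ z * f z =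
      ∫ z, diskWeight γ z * f ⟨z.re * Real.cos τ + z.im * Real.sin τ,
        z.im * Real.cos τ - z.re * Real.sin τ⟩ := by
  rw [← (rotation (Circle.exp (-τ))).measurePreserving.integral_comp
    (rotation (Circle.exp (-τ))).toHomeomorph.measurableEmbedding]
  congr 1; ext z
  have hz : rotation (Circle.exp (-τ)) z = ⟨z.re * Real.cos τ + z.im * Real.sin τ,
      z.im * Real.cos τ - z.re * Real.sin τ⟩ := by
    rw [rotation_apply, Circle.coe_exp]
    apply Complex.ext <;>
    simp [Complex.exp_re, Complex.exp_im] <;> ring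
  have hw : diskWeight γ (rotation (Circle.exp (-τ)) z) = diskWeight γ z := by
    classical
    simp only [diskWeight, indicator_apply, mem_ball_zero_iff, LinearIsometryEquiv.norm_map]
  rw [hw, hz]

/-- A form of the product formula for the polynomials `L n`. -/
theorem IsMonicOrtho.integral_weight_mul_eval {γ : ℝ} (hγ : -1 < γ) {L : ℕ → Polynomial ℝ}
    (hL : IsMonicOrtho γ L) (n : ℕ) (τ : ℝ) {s : ℝ} (hs : s ∈ Icc (-1:ℝ) 1) :
    ∫ v in (-1:ℝ)..1, (((1 - v ^ 2) ^ γ : ℝ) : ℂ) *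
        ((L n).eval (√(1 - s ^ 2) * v * Real.sin τ + s * Real.cos τ) : ℝ) =
      (∫ v in (-1:ℝ)..1, (((1 - v ^ 2) ^ γ : ℝ) : ℂ) *
        (Complex.I * v * Real.sin τ + Real.cos τ) ^ n) * ((L n).eval s : ℝ) := by
  obtain ⟨hm, hd, hLo⟩ := hL n
  obtain ⟨q, hqd, hqe, hqc⟩ :=
    exists_polynomial_weighted_mean hγ (Real.sin τ) (Real.cos τ) hd.le
  have ho : ∀ m < n, ∫ x in (-1:ℝ)..1, q.eval x * x ^ m * (1 - x ^ 2) ^ (γ + 1/2) = 0 := by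
    intro m hmn
    obtain ⟨r, hrd, hre, -⟩ :=
      exists_polynomial_weighted_add_pow hγ (-Real.sin τ) (Real.cos τ) m
    have h1 := integral_diskWeight_mul hγ
      (f := fun z => (L n).eval (z.re * Real.sin τ + z.im * Real.cos τ) * z.im ^ m) (by fun_prop)
    have h2 := integral_diskWeight_mul hγ
      (f := fun z => (L n).eval z.im * (z.re * -Real.sin τ + z.im * Real.cos τ) ^ m) (by fun_prop)
    have h3 : ∫ x in (-1:ℝ)..1, q.eval x * x ^ m * (1 - x ^ 2) ^ (γ + 1/2) =
        ∫ x in (-1:ℝ)..1, (L n).eval x * r.eval x * (1 - x ^ 2) ^ (γ + 1/2) := by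
      trans ∫ z, diskWeight γ z *
        ((L n).eval (z.re * Real.sin τ + z.im * Real.cos τ) * z.im ^ m)
      · rw [h1]
        refine intervalIntegral.integral_congr fun x hx => ?_
        rw [uIcc_of_le (by norm_num)] at hx
        dsimp only
        simp only [← mul_assoc]
        rw [intervalIntegral.integral_mul_const, ← hqe x hx]
        ring
      · rw [integral_diskWeight_mul_rotation γ τ]
        have hrot : ∀ a b : ℝ, (a * Real.cos τ + b * Real.sin τ) * Real.sin τ +
            (b * Real.cos τ - a * Real.sin τ) * Real.cos τ = b := fun a b => by
          linear_combination b * Real.sin_sq_add_cos_sq τ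
        have hneg : ∀ a b : ℝ, b * Real.cos τ - a * Real.sin τ =
            a * -Real.sin τ + b * Real.cos τ := fun a b => by ring
        simp only [hrot]
        simp only [hneg]
        rw [h2]
        refine intervalIntegral.integral_congr fun x hx => ?_
        rw [uIcc_of_le (by norm_num)] at hx
        dsimp only
        simp only [mul_left_comm _ ((L n).eval x)]
        rw [intervalIntegral.integral_const_mul, ← hre x hx]
        ring
    rw [h3]
    have h4 : ∀ x : ℝ, (L n).eval x * r.eval x * (1 - x ^ 2) ^ (γ + 1/2) =
        ∑ j ∈ Finset.range (m + 1),
          r.coeff j * ((L n).eval x * x ^ j * (1 - x ^ 2) ^ (γ + 1/2)) := fun x => by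
      rw [Polynomial.eval_eq_sum_range' (Nat.lt_succ_of_le hrd), Finset.mul_sum, Finset.sum_mul]
      exact Finset.sum_congr rfl fun j _ => by ring
    simp only [h4]
    rw [intervalIntegral.integral_finsetSum]
    · refine Finset.sum_eq_zero fun j hj => ?_
      rw [intervalIntegral.integral_const_mul, hLo j, mul_zero]
      have := Finset.mem_range.1 hj
      omega
    · intro j _
      simpa only [mul_comm, mul_left_comm, mul_assoc] using
        intervalIntegrable_weight_mul (γ := γ + 1/2) (by linarith)
          (g := fun x => r.coeff j * ((L n).eval x * x ^ j)) (by fun_prop)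
  have hq := hL.eq_C_mul hγ hqd ho
  have hlead : (L n).coeff n = 1 := by rw [← hm.coeff_natDegree, hd]
  rw [hlead, Complex.ofReal_one, one_mul] at hqc
  have hqs := hqe s hs
  rw [hq, Polynomial.eval_mul, Polynomial.eval_C] at hqs
  rw [← hqc, ← Complex.ofReal_mul, hqs, ← intervalIntegral.integral_ofReal]
  congr 1; ext v
  push_cast
  ring

theorem integral_weight_mul_integral_swap {γ : ℝ} (hγ : -1 < γ) {F : ℝ → ℝ → ℂ}
    (hF : Continuous (Function.uncurry F)) :
    ∫ v in (-1:ℝ)..1, (((1 - v ^ 2) ^ γ : ℝ) : ℂ) * ∫ φ in (0:ℝ)..(2 * π), F v φ =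
      ∫ φ in (0:ℝ)..(2 * π), ∫ v in (-1:ℝ)..1, (((1 - v ^ 2) ^ γ : ℝ) : ℂ) * F v φ := by
  simp only [← intervalIntegral.integral_const_mul]
  simp only [intervalIntegral.integral_of_le Real.two_pi_pos.le,
    intervalIntegral.integral_of_le (show (-1:ℝ) ≤ 1 by norm_num)]
  refine integral_integral_swap ?_
  obtain ⟨C, hC⟩ := (isCompact_Icc.prod isCompact_Icc).exists_bound_of_continuousOn
    (s := Icc (-1:ℝ) 1 ×ˢ Icc 0 (2 * π)) hF.continuousOn
  have hw := intervalIntegrable_one_sub_sq_rpow hγ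
  rw [intervalIntegrable_iff_integrableOn_Ioc_of_le (by norm_num)] at hw
  have hg := hw.integrable.norm.mul_prod
    (integrable_const (μ := volume.restrict (Ioc 0 (2 * π))) C)
  refine hg.mono' ?_ ?_
  · refine Measurable.aestronglyMeasurable ?_
    exact Measurable.mul (by fun_prop) hF.measurable
  · rw [Measure.prod_restrict]
    filter_upwards [ae_restrict_mem (measurableSet_Ioc.prod measurableSet_Ioc)] with p hp
    simp only [Function.uncurry, norm_mul, Complex.norm_real]
    exact mul_le_mul_of_nonneg_left
      (hC p ⟨Ioc_subset_Icc_self hp.1, Ioc_subset_Icc_self hp.2⟩) (norm_nonneg _)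

theorem GZ_eq_integral_eval_im (γ : ℝ) (L : ℕ → Polynomial ℝ) (n : ℕ) (k : ℤ) (z : ℂ) :
    GZ γ L n k z = ((1 / (2 * π) : ℝ) : ℂ) * ∫ φ in (0:ℝ)..(2 * π),
      Complex.exp (Complex.I * ((n : ℂ) - 2 * (k : ℂ)) * (φ : ℂ)) *
        ((L n).eval (z * Complex.exp (-(φ : ℂ) * Complex.I)).im : ℝ) := by
  rw [GZ]
  congr 2; ext φ
  have : (Complex.I / 2) * ((starRingEnd ℂ) z * Complex.exp ((φ : ℂ) * Complex.I) -
      z * Complex.exp (-(φ : ℂ) * Complex.I)) =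
      algebraMap ℝ ℂ (z * Complex.exp (-(φ : ℂ) * Complex.I)).im := by
    have hconj : (starRingEnd ℂ) z * Complex.exp ((φ : ℂ) * Complex.I) =
        (starRingEnd ℂ) (z * Complex.exp (-(φ : ℂ) * Complex.I)) := by
      rw [map_mul, ← Complex.exp_conj]
      simp
    rw [hconj]
    generalize z * Complex.exp (-(φ : ℂ) * Complex.I) = w
    apply Complex.ext <;> simp
    ring
  rw [this, Polynomial.aeval_algebraMap_apply]
  simp

theorem integral_exp_int_mul (m : ℤ) :
    ∫ φ in (0:ℝ)..(2 * π), Complex.exp (Complex.I * m * φ) = if m = 0 then 2 * (π : ℂ) else 0 := by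
  split_ifs with h
  · simp [h]
  · have hc : Complex.I * (m : ℂ) ≠ 0 := by simpa using h
    rw [integral_exp_mul_complex hc]
    have : Complex.exp (Complex.I * m * ((2 * π : ℝ) : ℂ)) = 1 := by
      rw [Complex.exp_eq_one_iff]
      exact ⟨m, by push_cast; ring⟩
    rw [this]
    simp

theorem integral_exp_mul_pow {n k : ℕ} (hk : k ≤ n) (θ v : ℝ) :
    ∫ φ in (0:ℝ)..(2 * π), Complex.exp (Complex.I * ((n : ℂ) - 2 * ((k : ℤ) : ℂ)) * (φ : ℂ)) *
        (Complex.I * v * Real.sin (θ - φ) + Real.cos (θ - φ)) ^ n =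
      2 * π * n.choose k * Complex.exp (Complex.I * ((n : ℂ) - 2 * ((k : ℤ) : ℂ)) * (θ : ℂ)) *
        ((((1 + v) / 2) ^ (n - k) * ((1 - v) / 2) ^ k : ℝ) : ℂ) := by
  have hterm : ∀ φ : ℝ, Complex.exp (Complex.I * ((n : ℂ) - 2 * ((k : ℤ) : ℂ)) * (φ : ℂ)) *
        (Complex.I * v * Real.sin (θ - φ) + Real.cos (θ - φ)) ^ n =
      ∑ j ∈ Finset.range (n + 1), ((n.choose j : ℂ) * ((1 - v) / 2) ^ j * ((1 + v) / 2) ^ (n - j) *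
        Complex.exp (Complex.I * ((n : ℂ) - 2 * (j : ℂ)) * (θ : ℂ))) *
          Complex.exp (Complex.I * ((2 * ((j : ℤ) - (k : ℤ)) : ℤ) : ℂ) * φ) := by
    intro φ
    have hb : Complex.I * v * Real.sin (θ - φ) + Real.cos (θ - φ) =
        (1 - v) / 2 * Complex.exp (-(((θ - φ : ℝ) : ℂ) * Complex.I)) +
        (1 + v) / 2 * Complex.exp (((θ - φ : ℝ) : ℂ) * Complex.I) := by
      rw [← neg_mul, Complex.exp_mul_I, Complex.exp_mul_I, Complex.cos_neg, Complex.sin_neg,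
        Complex.ofReal_sin, Complex.ofReal_cos]
      ring
    rw [hb, add_pow, Finset.mul_sum]
    refine Finset.sum_congr rfl fun j hj => ?_
    have hj := Finset.mem_range_succ_iff.1 hj
    rw [mul_pow, mul_pow, ← Complex.exp_nat_mul, ← Complex.exp_nat_mul, Nat.cast_sub hj]
    have he : Complex.exp (Complex.I * ((n : ℂ) - 2 * ((k : ℤ) : ℂ)) * (φ : ℂ)) *
        Complex.exp ((j : ℂ) * -(((θ - φ : ℝ) : ℂ) * Complex.I)) *
        Complex.exp (((n : ℂ) - j) * (((θ - φ : ℝ) : ℂ) * Complex.I)) =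
        Complex.exp (Complex.I * ((n : ℂ) - 2 * (j : ℂ)) * (θ : ℂ)) *
          Complex.exp (Complex.I * ((2 * ((j : ℤ) - (k : ℤ)) : ℤ) : ℂ) * φ) := by
      simp only [← Complex.exp_add]
      congr 1
      push_cast
      ring
    linear_combination ((n.choose j : ℂ) * ((1 - v) / 2) ^ j * ((1 + v) / 2) ^ (n - j)) * he
  simp only [hterm]
  rw [intervalIntegral.integral_finsetSum fun j _ =>
    Continuous.intervalIntegrable (by fun_prop) _ _]
  simp only [intervalIntegral.integral_const_mul, integral_exp_int_mul]
  rw [Finset.sum_eq_single k]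
  · simp
    ring
  · intro j _ hjk
    rw [if_neg (by omega), mul_zero]
  · intro h
    exact absurd (Finset.mem_range_succ_iff.2 hk) h

theorem sigSq_eq_integral {γ : ℝ} (hγ : -1 < γ) {n k : ℕ} (hk : k ≤ n) :
    sigSq γ n k = 2 * π * n.choose k *
      ∫ v in (-1:ℝ)..1, (1 - v ^ 2) ^ γ * (((1 + v) / 2) ^ (n - k) * ((1 - v) / 2) ^ k) := by
  have h : (2 : ℝ) ^ (2 * γ + 2) = 2 ^ (2 * γ + 1) * 2 := by
    rw [← Real.rpow_add_one two_ne_zero]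
    ring_nf
  rw [integral_one_sub_sq_rpow_mul hγ, Nat.cast_sub hk, sub_add_cancel, sigSq, h]
  ring

/-- The weighted chord averages of `GZ` are multiples of the functions
`exp (i (n - 2k) θ) * L n (s)`. -/
theorem integral_weight_mul_GZ {γ : ℝ} (hγ : -1 < γ) {L : ℕ → Polynomial ℝ}
    (hL : IsMonicOrtho γ L) {n k : ℕ} (hk : k ≤ n) (θ : ℝ) {s : ℝ} (hs : s ∈ Icc (-1:ℝ) 1) :
    ∫ v in (-1:ℝ)..1, (((1 - v ^ 2) ^ γ : ℝ) : ℂ) * GZ γ L n (k : ℤ)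
        (Complex.exp ((θ : ℂ) * Complex.I) * (((√(1 - s ^ 2) * v : ℝ) : ℂ) + s * Complex.I)) =
      ((sigSq γ n k : ℝ) : ℂ) * (((1 / (2 * π) : ℝ) : ℂ) *
        (Complex.exp (Complex.I * ((n : ℂ) - 2 * ((k : ℤ) : ℂ)) * (θ : ℂ)) *
          ((L n).eval s : ℝ))) := by
  have him : ∀ v φ : ℝ, (Complex.exp ((θ : ℂ) * Complex.I) *
      (((√(1 - s ^ 2) * v : ℝ) : ℂ) + s * Complex.I) * Complex.exp (-(φ : ℂ) * Complex.I)).im =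
      √(1 - s ^ 2) * v * Real.sin (θ - φ) + s * Real.cos (θ - φ) := fun v φ => by
    rw [mul_right_comm, ← Complex.exp_add, ← add_mul, ← sub_eq_add_neg, ← Complex.ofReal_sub]
    rw [Complex.mul_im, Complex.exp_ofReal_mul_I_re, Complex.exp_ofReal_mul_I_im]
    simp
    ring
  simp only [GZ_eq_integral_eval_im, him, mul_left_comm _ (((1 / (2 * π) : ℝ) : ℂ))]
  rw [intervalIntegral.integral_const_mul, integral_weight_mul_integral_swap hγ (by fun_prop)]
  simp only [mul_left_comm _ (Complex.exp _)]
  simp only [intervalIntegral.integral_const_mul, hL.integral_weight_mul_eval hγ n _ hs]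
  have h1 := integral_weight_mul_integral_swap hγ (F := fun v φ =>
    Complex.exp (Complex.I * ((n : ℂ) - 2 * ((k : ℤ) : ℂ)) * (φ : ℂ)) *
        (Complex.I * v * Real.sin (θ - φ) + Real.cos (θ - φ)) ^ n) (by fun_prop)
  simp only [integral_exp_mul_pow hk, mul_left_comm _ (Complex.exp _),
    intervalIntegral.integral_const_mul] at h1
  simp only [← mul_assoc, intervalIntegral.integral_mul_const] at h1 ⊢
  rw [← h1]
  have h2 : ∫ v in (-1:ℝ)..1, (((1 - v ^ 2) ^ γ : ℝ) : ℂ) * 2 * (π : ℂ) * (n.choose k : ℂ) *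
      Complex.exp (Complex.I * ((n : ℂ) - 2 * ((k : ℤ) : ℂ)) * (θ : ℂ)) *
        ((((1 + v) / 2) ^ (n - k) * ((1 - v) / 2) ^ k : ℝ) : ℂ) =
      Complex.exp (Complex.I * ((n : ℂ) - 2 * ((k : ℤ) : ℂ)) * (θ : ℂ)) *
        ((sigSq γ n k : ℝ) : ℂ) := by
    rw [sigSq_eq_integral hγ hk, Complex.ofReal_mul, ← intervalIntegral.integral_ofReal,
      ← mul_assoc, ← intervalIntegral.integral_const_mul]
    congr 1
    ext v
    push_cast
    ring
  push_cast at h2 ⊢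
  rw [h2]
  ring

theorem chord_betam_alpham {z : ℂ} {θ s : ℝ} (hz : (z * Complex.exp (-(θ : ℂ) * Complex.I)).im = s)
    (hs : s ∈ Icc (-1:ℝ) 1) (t : ℝ) :
    chord (wrap (betam z θ)) (alpham z θ) t = Complex.exp ((θ : ℂ) * Complex.I) *
      (((t - √(1 - s ^ 2) : ℝ) : ℂ) + s * Complex.I) := by
  have hw : ∃ m : ℤ, wrap (betam z θ) = betam z θ - m * (2 * π) :=
    ⟨toIocDiv Real.two_pi_pos 0 (betam z θ), by
      rw [wrap, toIocMod, zsmul_eq_mul]⟩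
  obtain ⟨m, hm⟩ := hw
  have hα : alpham z θ = Real.arcsin s := by rw [alpham, hz]
  have hper : ∀ x : ℝ, Complex.exp (((x - m * (2 * π) : ℝ) : ℂ) * Complex.I) =
      Complex.exp ((x : ℂ) * Complex.I) := fun x => by
    rw [Complex.exp_eq_exp_iff_exists_int]
    exact ⟨-m, by push_cast; ring⟩
  have h1 : wrap (betam z θ) + π + alpham z θ = θ - m * (2 * π) := by
    rw [hm, betam]; ring
  have h2 : ((betam z θ : ℝ) : ℂ) * Complex.I =
      (θ : ℂ) * Complex.I + ((-(Real.arcsin s) : ℝ) : ℂ) * Complex.I - π * Complex.I := by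
    rw [betam, hα]; push_cast; ring
  rw [chord, h1, hper, hm, hper, h2, Complex.exp_sub_pi_mul_I, Complex.exp_add,
    Complex.exp_mul_I ((-(Real.arcsin s) : ℝ) : ℂ), ← Complex.ofReal_cos, ← Complex.ofReal_sin,
    Real.cos_neg, Real.sin_neg, Real.cos_arcsin, Real.sin_arcsin hs.1 hs.2]
  push_cast
  ring

theorem cos_rpow_mul_XRT (γ : ℝ) (G : ℂ → ℂ) {z : ℂ} {θ s : ℝ}
    (hz : (z * Complex.exp (-(θ : ℂ) * Complex.I)).im = s) (hs : s ∈ Ioo (-1:ℝ) 1) :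
    ((Real.cos (alpham z θ) ^ (-(2 * γ) - 1) : ℝ) : ℂ) *
        XRT (fun w => (((1 - ‖w‖ ^ 2) ^ γ : ℝ) : ℂ) * G w) (wrap (betam z θ)) (alpham z θ) =
      ∫ v in (-1:ℝ)..1, (((1 - v ^ 2) ^ γ : ℝ) : ℂ) *
        G (Complex.exp ((θ : ℂ) * Complex.I) *
          (((√(1 - s ^ 2) * v : ℝ) : ℂ) + s * Complex.I)) := by
  have hs' : 0 < 1 - s ^ 2 := by nlinarith [hs.1, hs.2]
  have hcos : Real.cos (alpham z θ) = √(1 - s ^ 2) := by rw [alpham, hz, Real.cos_arcsin]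
  have hc : 0 < √(1 - s ^ 2) := Real.sqrt_pos.2 hs'
  have hsq := Real.sq_sqrt hs'.le
  simp only [XRT, chord_betam_alpham hz (Ioo_subset_Icc_self hs), hcos]
  set c := √(1 - s ^ 2)
  have hnorm : ∀ u : ℝ, 1 - ‖Complex.exp ((θ : ℂ) * Complex.I) * ((u : ℂ) + s * Complex.I)‖ ^ 2 =
      c ^ 2 - u ^ 2 := fun u => by
    rw [norm_mul, Complex.norm_exp_ofReal_mul_I, one_mul, Complex.sq_norm, Complex.normSq_add_mul_I]
    linarith
  rw [intervalIntegral.integral_comp_sub_right (fun u : ℝ =>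
    (((1 - ‖Complex.exp ((θ : ℂ) * Complex.I) * ((u : ℂ) + s * Complex.I)‖ ^ 2) ^ γ : ℝ) : ℂ) *
      G (Complex.exp ((θ : ℂ) * Complex.I) * ((u : ℂ) + s * Complex.I))),
    zero_sub, show 2 * c - c = c by ring]
  simp only [hnorm]
  have h := integral_sq_sub_sq_rpow_smul γ hc fun u : ℝ =>
    G (Complex.exp ((θ : ℂ) * Complex.I) * ((u : ℂ) + s * Complex.I))
  simp only [Complex.real_smul] at h
  rw [h, ← mul_assoc, ← Complex.ofReal_mul]
  have hone : c ^ (-(2 * γ) - 1) * (c ^ 2) ^ (γ + 1/2) = 1 := by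
    rw [← Real.rpow_natCast, ← Real.rpow_mul hc.le, ← Real.rpow_add hc]
    convert Real.rpow_zero c using 2
    push_cast
    ring
  rw [hone, Complex.ofReal_one, one_mul]

theorem countable_setOf_exp_mul_I_eq (a : ℂ) :
    {θ : ℝ | Complex.exp ((θ : ℂ) * Complex.I) = a}.Countable := by
  rcases Set.eq_empty_or_nonempty {θ : ℝ | Complex.exp ((θ : ℂ) * Complex.I) = a} with h | ⟨θ₀, h⟩
  · simp [h]
  · refine (Set.countable_range fun m : ℤ => θ₀ + m * (2 * π)).mono fun θ hθ => ?_
    obtain ⟨m, hm⟩ := Complex.exp_eq_exp_iff_exists_int.1 (hθ.trans h.symm)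
    refine ⟨m, ?_⟩
    have h1 : (θ : ℂ) * Complex.I = ((θ₀ + m * (2 * π) : ℝ) : ℂ) * Complex.I := by
      rw [hm]; push_cast; ring
    exact_mod_cast (mul_right_cancel₀ Complex.I_ne_zero h1).symm

/-- Almost every line through a point of the closed disk is not tangent to the boundary. -/
theorem ae_im_mul_exp_mem_Ioo {z : ℂ} (hz : ‖z‖ ≤ 1) :
    ∀ᵐ θ : ℝ, (z * Complex.exp (-(θ : ℂ) * Complex.I)).im ∈ Ioo (-1:ℝ) 1 := by
  filter_upwards [(countable_setOf_exp_mul_I_eq (z * Complex.I)).ae_notMem volume,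
    (countable_setOf_exp_mul_I_eq (-(z * Complex.I))).ae_notMem volume] with θ h1 h2
  set w := z * Complex.exp (-(θ : ℂ) * Complex.I) with hw
  have hzw : z = w * Complex.exp ((θ : ℂ) * Complex.I) := by
    rw [hw, mul_assoc, ← Complex.exp_add, neg_mul, neg_add_cancel, Complex.exp_zero, mul_one]
  have hwn : ‖w‖ ≤ 1 := by
    rw [hzw, norm_mul, Complex.norm_exp_ofReal_mul_I, mul_one] at hz
    exact hz
  have hw2 : w.re ^ 2 + w.im ^ 2 ≤ 1 := by
    have := Complex.sq_norm w
    rw [Complex.normSq_apply] at this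
    nlinarith [norm_nonneg w]
  by_contra hcon
  have him : w.im = 1 ∨ w.im = -1 := by
    by_contra! hne
    refine hcon ⟨lt_of_le_of_ne ?_ hne.2.symm, lt_of_le_of_ne ?_ hne.1⟩ <;>
    nlinarith [sq_nonneg w.re]
  have hre : w.re = 0 := by
    rcases him with h | h <;> rw [h] at hw2 <;> nlinarith [sq_nonneg w.re]
  rcases him with h | h
  · have : w = Complex.I := Complex.ext (by simp [hre]) (by simp [h])
    refine h2 ?_
    rw [this] at hzw
    linear_combination Complex.I * hzw + Complex.exp ((θ : ℂ) * Complex.I) * Complex.I_sq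
  · have : w = -Complex.I := Complex.ext (by simp [hre]) (by simp [h])
    refine h1 ?_
    rw [this] at hzw
    linear_combination -Complex.I * hzw + Complex.exp ((θ : ℂ) * Complex.I) * Complex.I_sq

/-- The eigenequation for the normal operator:
`I₀^♯(μ^{-2γ-1} I₀(d^γ G_{n,k}^γ)) = (σ_{n,k}^γ)² G_{n,k}^γ` on `𝔻`. -/
theorem normal_operator_eigenequation (γ : ℝ) (hγ : -1 < γ)
    (L : ℕ → Polynomial ℝ) (hL : IsMonicOrtho γ L) (n k : ℕ) (hk : k ≤ n) :
    ∀ z ∈ Metric.closedBall (0 : ℂ) 1,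
      BPW γ (fun p => XRT (fun w => (((1 - ‖w‖ ^ 2) ^ γ : ℝ) : ℂ) * GZ γ L n (k : ℤ) w) p.1 p.2) z
        = ((sigSq γ n k : ℝ) : ℂ) * GZ γ L n (k : ℤ) z := by
  intro z hz
  rw [mem_closedBall_zero_iff] at hz
  rw [BPW, BP, GZ_eq_integral_eval_im, ← intervalIntegral.integral_const_mul,
    ← intervalIntegral.integral_const_mul]
  refine intervalIntegral.integral_congr_ae ?_
  filter_upwards [ae_im_mul_exp_mem_Ioo hz] with θ hs _
  rw [cos_rpow_mul_XRT γ (GZ γ L n (k : ℤ)) rfl hs,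
    integral_weight_mul_GZ hγ hL hk θ (Ioo_subset_Icc_self hs)]

end
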